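/- O(1/n) convergence of the relaxed block Jacobi method: let p⁽⁰⁾ ∈ C and for each n let p⁽ⁿ⁺¹⁾ = (1/N_c) Σ_{k=1}^{N_c} S̄_k(p⁽ⁿ⁾), where S̄_k(q) = R_k* s_k + (I − R_k* R_k) q with s_k ∈ C_k any minimizer of F_k(·; q) over C_k. Let p* be a minimizer of F over C. Then for any n ≥ 1, F(p⁽ⁿ⁾) − F(p*) ≤ [N_c · D(p*, p⁽⁰⁾) + (N_c − 1)(F(p⁽⁰⁾) − F(p*))] / n. -/

import Mathlib

open Finset

noncomputable section

/-- The discrete image domain of `M × N` pixels. -/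
abbrev Idx (M N : ℕ) := Fin M × Fin N

/-- The discrete divergence operator `div : W → V`, the negative adjoint of
the discrete gradient. -/
def divOp {M N : ℕ} (p : Idx M N → ℝ × ℝ) : Idx M N → ℝ := fun x =>
  ((if (x.1 : ℕ) + 1 < M then (p x).1 else 0)
    - (if 1 ≤ (x.1 : ℕ) then
        (p (⟨(x.1 : ℕ) - 1, lt_of_le_of_lt (Nat.sub_le _ _) x.1.isLt⟩, x.2)).1 else 0))
  + ((if (x.2 : ℕ) + 1 < N then (p x).2 else 0)
    - (if 1 ≤ (x.2 : ℕ) then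
        (p (x.1, ⟨(x.2 : ℕ) - 1, lt_of_le_of_lt (Nat.sub_le _ _) x.2.isLt⟩)).2 else 0))

/-- The discrete gradient operator `∇ : V → W`. -/
def gradOp {M N : ℕ} (u : Idx M N → ℝ) : Idx M N → ℝ × ℝ := fun x =>
  ((if h : (x.1 : ℕ) + 1 < M then u (⟨(x.1 : ℕ) + 1, h⟩, x.2) - u x else 0),
   (if h : (x.2 : ℕ) + 1 < N then u (x.1, ⟨(x.2 : ℕ) + 1, h⟩) - u x else 0))

/-- Euclidean inner product on `V`. -/
def innerV {M N : ℕ} (u v : Idx M N → ℝ) : ℝ := ∑ x, u x * v x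

/-- Euclidean inner product on `W`. -/
def innerW {M N : ℕ} (p q : Idx M N → ℝ × ℝ) : ℝ :=
  ∑ x, ((p x).1 * (q x).1 + (p x).2 * (q x).2)

/-- Squared Euclidean norm on `V`. -/
def normVsq {M N : ℕ} (u : Idx M N → ℝ) : ℝ := ∑ x, (u x) ^ 2

/-- Max (Euclidean-pointwise) norm on `W`. -/
def normWinf {M N : ℕ} (p : Idx M N → ℝ × ℝ) : ℝ :=
  ⨆ x : Idx M N, Real.sqrt ((p x).1 ^ 2 + (p x).2 ^ 2)

/-- The dual ROF energy `F(p) = (1/2)‖div p + α f‖₂²`. -/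
def F {M N : ℕ} (α : ℝ) (f : Idx M N → ℝ) (p : Idx M N → ℝ × ℝ) : ℝ :=
  (1 / 2) * normVsq (fun x => divOp p x + α * f x)

/-- The gradient of `F`, namely `∇F(q) = div*(div q + α f) = -∇(div q + α f)`. -/
def gradF {M N : ℕ} (α : ℝ) (f : Idx M N → ℝ) (q : Idx M N → ℝ × ℝ) :
    Idx M N → ℝ × ℝ :=
  fun x => - gradOp (fun y => divOp q y + α * f y) x

/-- The constraint set `C = {p ∈ W : |p_{ij}| ≤ 1 ∀ (i,j)}`. -/
def Cset (M N : ℕ) : Set (Idx M N → ℝ × ℝ) :=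
  {p | ∀ x, Real.sqrt ((p x).1 ^ 2 + (p x).2 ^ 2) ≤ 1}

/-- Restriction operator `R_k : W → W_k`. -/
def Rk {M N : ℕ} (S : Finset (Idx M N)) (p : Idx M N → ℝ × ℝ) :
    {x // x ∈ S} → ℝ × ℝ :=
  fun x => p x.1

/-- Extension-by-zero operator `R_k* : W_k → W`. -/
def Ek {M N : ℕ} (S : Finset (Idx M N)) (pk : {x // x ∈ S} → ℝ × ℝ) :
    Idx M N → ℝ × ℝ :=
  fun x => if h : x ∈ S then pk ⟨x, h⟩ else 0

/-- The orthogonal projection `R_k* R_k : W → W`. -/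
def projk {M N : ℕ} (S : Finset (Idx M N)) (p : Idx M N → ℝ × ℝ) :
    Idx M N → ℝ × ℝ :=
  fun x => if x ∈ S then p x else 0

/-- The local constraint set `C_k = R_k C`. -/
def Ck {M N : ℕ} (S : Finset (Idx M N)) : Set ({x // x ∈ S} → ℝ × ℝ) :=
  Rk S '' Cset M N

/-- The local energy `F_k(p_k; r) = F(R_k* p_k + (I - R_k* R_k) r)`. -/
def Fk {M N : ℕ} (α : ℝ) (f : Idx M N → ℝ) (S : Finset (Idx M N))
    (pk : {x // x ∈ S} → ℝ × ℝ) (r : Idx M N → ℝ × ℝ) : ℝ :=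
  F α f (Ek S pk + (r - projk S r))

/-- Euclidean inner product on `W_k`. -/
def innerWk {M N : ℕ} (S : Finset (Idx M N)) (pk qk : {x // x ∈ S} → ℝ × ℝ) : ℝ :=
  ∑ x : {x // x ∈ S}, ((pk x).1 * (qk x).1 + (pk x).2 * (qk x).2)

/-- The distance-like quantity `D(p,q) = Σ_k (1/2)‖div R_k* R_k (p - q)‖₂²`. -/
def Ddist {M N Nc : ℕ} (S : Fin Nc → Finset (Idx M N))
    (p q : Idx M N → ℝ × ℝ) : ℝ :=
  ∑ k, (1 / 2) * normVsq (divOp (projk (S k) (p - q)))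

/-- The rectangular subdomain `Ω_s` of size `m × n` indexed by `s : Fin Ms × Fin Ns`
(for an `M × N` image with `M = Ms * m`, `N = Ns * n`). -/
def block {M N Ms Ns : ℕ} (m n : ℕ) (s : Fin Ms × Fin Ns) : Finset (Idx M N) :=
  Finset.univ.filter fun x => (x.1 : ℕ) / m = (s.1 : ℕ) ∧ (x.2 : ℕ) / n = (s.2 : ℕ)

end

section InnerProduct

variable {H : Type*} [NormedAddCommGroup H] [InnerProductSpace ℝ H]

/-- First-order optimality for the squared norm along a segment. -/
lemma inner_nonneg_of_norm_sq_le_segment {u v : H}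
    (h : ∀ t : ℝ, 0 ≤ t → t ≤ 1 → ‖u‖ ^ 2 ≤ ‖u + t • v‖ ^ 2) : 0 ≤ inner ℝ u v := by
  by_contra! hneg
  have key : ∀ t : ℝ, 0 ≤ t → t ≤ 1 → 0 ≤ 2 * (t * inner ℝ u v) + t ^ 2 * ‖v‖ ^ 2 := by
    intro t h0 h1
    have := h t h0 h1
    rw [norm_add_sq_real, inner_smul_right, norm_smul, mul_pow, Real.norm_eq_abs, sq_abs] at this
    linarith
  generalize inner ℝ u v = i at *
  have hn := sq_nonneg ‖v‖
  generalize ‖v‖ ^ 2 = n at *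
  have hpos : 0 < n - i := by linarith
  have ht0 : 0 < -i / (n - i) := div_pos (by linarith) hpos
  have ht1 : -i / (n - i) ≤ 1 := by rw [div_le_one hpos]; linarith
  have hk := key _ ht0.le ht1
  have hmul : -i / (n - i) * (n - i) = -i := div_mul_cancel₀ _ hpos.ne'
  generalize -i / (n - i) = t at *
  nlinarith [mul_pos ht0 (neg_pos.2 hneg)]

/-- Jensen's inequality for the squared norm with equal weights. -/
lemma card_mul_norm_sq_average_le {m : ℕ} (hm : m ≠ 0) (g : H) (a : Fin m → H) :
    (m : ℝ) * ‖g + (1 / (m : ℝ)) • ∑ k, a k‖ ^ 2 ≤ ∑ k, ‖g + a k‖ ^ 2 := by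
  have hm0 : (m : ℝ) ≠ 0 := Nat.cast_ne_zero.2 hm
  have hmpos : (0 : ℝ) < m := by positivity
  have hsum : ‖∑ k, a k‖ ^ 2 ≤ m * ∑ k, ‖a k‖ ^ 2 := by
    calc ‖∑ k, a k‖ ^ 2 ≤ (∑ k, ‖a k‖) ^ 2 := by gcongr; exact norm_sum_le _ _
      _ ≤ m * ∑ k, ‖a k‖ ^ 2 := by
        simpa using sq_sum_le_card_mul_sum_sq (s := univ) (f := fun k => ‖a k‖)
  have hdiv : ‖∑ k, a k‖ ^ 2 / m ≤ ∑ k, ‖a k‖ ^ 2 := by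
    rw [div_le_iff₀ hmpos]; linarith
  simp only [norm_add_sq_real, sum_add_distrib, ← mul_sum, ← inner_sum, inner_smul_right,
    norm_smul, mul_pow, Real.norm_eq_abs, sq_abs, sum_const, card_univ, Fintype.card_fin,
    nsmul_eq_mul]
  calc (m : ℝ) * (‖g‖ ^ 2 + 2 * (1 / m * inner ℝ g (∑ k, a k)) + (1 / m) ^ 2 * ‖∑ k, a k‖ ^ 2)
      = m * ‖g‖ ^ 2 + 2 * inner ℝ g (∑ k, a k) + ‖∑ k, a k‖ ^ 2 / m := by
        field_simp
    _ ≤ _ := by linarith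

/-- One step of the relaxed block Jacobi method: `g` is the current residual, `a k` the image of
the `k`-th local correction and `b k` the image of the `k`-th component of the error. -/
lemma relaxed_jacobi_step {m : ℕ} (hm : m ≠ 0) (g : H) (a b : Fin m → H)
    (hopt : ∀ k, 0 ≤ inner ℝ (g + a k) (b k - a k)) :
    (m : ℝ) * (1 / 2 * ‖g + (1 / (m : ℝ)) • ∑ k, a k‖ ^ 2)
        + m * ∑ k, 1 / 2 * ‖b k - (1 / (m : ℝ)) • a k‖ ^ 2
      ≤ (m - 1) * (1 / 2 * ‖g‖ ^ 2) + 1 / 2 * ‖g + ∑ k, b k‖ ^ 2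
        + m * ∑ k, 1 / 2 * ‖b k‖ ^ 2 := by
  have hm0 : (m : ℝ) ≠ 0 := Nat.cast_ne_zero.2 hm
  have hm1 : (1 : ℝ) ≤ m := by exact_mod_cast Nat.one_le_iff_ne_zero.2 hm
  have hinv : 1 / (m : ℝ) ≤ 1 := by rw [div_le_one (by linarith)]; exact hm1
  have hJ := card_mul_norm_sq_average_le hm g a
  have hterm : ∀ k, ‖g + a k‖ ^ 2 + m * ‖b k - (1 / (m : ℝ)) • a k‖ ^ 2
      ≤ ‖g‖ ^ 2 + 2 * inner ℝ g (b k) + m * ‖b k‖ ^ 2 := by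
    intro k
    have ho := hopt k
    simp only [inner_add_left, inner_sub_right, real_inner_self_eq_norm_sq] at ho
    have hexp : (m : ℝ) * ‖b k - (1 / (m : ℝ)) • a k‖ ^ 2
        = m * ‖b k‖ ^ 2 - 2 * inner ℝ (a k) (b k) + 1 / m * ‖a k‖ ^ 2 := by
      rw [norm_sub_sq_real, inner_smul_right, norm_smul, mul_pow, Real.norm_eq_abs, sq_abs,
        real_inner_comm]
      field_simp
    have hle : 1 / (m : ℝ) * ‖a k‖ ^ 2 ≤ ‖a k‖ ^ 2 :=
      mul_le_of_le_one_left (sq_nonneg _) hinv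
    rw [hexp, norm_add_sq_real]
    linarith
  have hS := sum_le_sum fun k (_ : k ∈ univ) => hterm k
  simp only [sum_add_distrib, ← mul_sum, ← inner_sum, sum_const, card_univ, Fintype.card_fin,
    nsmul_eq_mul] at hS ⊢
  rw [norm_add_sq_real g (∑ k, b k)]
  nlinarith [sq_nonneg ‖∑ k, b k‖]

end InnerProduct

/-- The discrete divergence as a linear map into the Euclidean space of images. -/
noncomputable def divLin (M N : ℕ) :
    (Idx M N → ℝ × ℝ) →ₗ[ℝ] EuclideanSpace ℝ (Idx M N) where
  toFun p := WithLp.toLp 2 (divOp p)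
  map_add' p q := by
    ext x
    simp only [divOp, Pi.add_apply, Prod.fst_add, Prod.snd_add, PiLp.add_apply]
    split_ifs <;> ring
  map_smul' c p := by
    ext x
    simp only [divOp, Pi.smul_apply, Prod.smul_fst, Prod.smul_snd, PiLp.smul_apply, smul_eq_mul,
      RingHom.id_apply]
    split_ifs <;> ring

lemma normVsq_divOp {M N : ℕ} (p : Idx M N → ℝ × ℝ) :
    normVsq (divOp p) = ‖divLin M N p‖ ^ 2 := by
  simp [normVsq, EuclideanSpace.norm_sq_eq, divLin]

lemma F_eq_norm_sq {M N : ℕ} (α : ℝ) (f : Idx M N → ℝ) (p : Idx M N → ℝ × ℝ) :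
    F α f p = 1 / 2 * ‖divLin M N p + WithLp.toLp 2 (α • f)‖ ^ 2 := by
  simp [F, normVsq, EuclideanSpace.norm_sq_eq, divLin]

lemma convex_Cset (M N : ℕ) : Convex ℝ (Cset M N) := by
  intro p hp q hq a b ha hb hab x
  have h1 := Real.sqrt_le_one.1 (hp x)
  have h2 := Real.sqrt_le_one.1 (hq x)
  refine Real.sqrt_le_one.2 ?_
  simp only [Pi.add_apply, Pi.smul_apply, Prod.fst_add, Prod.snd_add, Prod.smul_fst,
    Prod.smul_snd, smul_eq_mul]
  obtain rfl : b = 1 - a := by linarith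
  nlinarith [mul_nonneg ha hb, mul_nonneg (mul_nonneg ha hb) (sq_nonneg ((p x).1 - (q x).1)),
    mul_nonneg (mul_nonneg ha hb) (sq_nonneg ((p x).2 - (q x).2)),
    mul_nonneg ha (sub_nonneg.2 h1), mul_nonneg hb (sub_nonneg.2 h2)]

lemma convex_Ck {M N : ℕ} (S : Finset (Idx M N)) : Convex ℝ (Ck S) :=
  (convex_Cset M N).is_linear_image ⟨fun _ _ => rfl, fun _ _ => rfl⟩

lemma Ek_add_mem_Cset {M N : ℕ} {S : Finset (Idx M N)} {pk : {x // x ∈ S} → ℝ × ℝ}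
    (hpk : pk ∈ Ck S) {r : Idx M N → ℝ × ℝ} (hr : r ∈ Cset M N) :
    Ek S pk + (r - projk S r) ∈ Cset M N := by
  obtain ⟨q, hq, rfl⟩ := hpk
  intro x
  by_cases hx : x ∈ S
  · simpa [Ek, projk, Rk, hx] using hq x
  · simpa [Ek, projk, hx] using hr x

lemma sum_projk {M N Nc : ℕ} {S : Fin Nc → Finset (Idx M N)}
    (hdisj : ∀ k l, k ≠ l → Disjoint (S k) (S l)) (hcover : ∀ x : Idx M N, ∃ k, x ∈ S k)
    (p : Idx M N → ℝ × ℝ) : ∑ k, projk (S k) p = p := by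
  funext x
  obtain ⟨k, hk⟩ := hcover x
  rw [Finset.sum_apply, Finset.sum_eq_single k]
  · simp [projk, hk]
  · intro l _ hl
    simp [projk, Finset.disjoint_left.1 (hdisj k l hl.symm) hk]
  · simp

lemma projk_sum_of_support {M N Nc : ℕ} {S : Fin Nc → Finset (Idx M N)}
    (hdisj : ∀ k l, k ≠ l → Disjoint (S k) (S l)) {d : Fin Nc → Idx M N → ℝ × ℝ}
    (hd : ∀ k, ∀ x ∉ S k, d k x = 0) (k : Fin Nc) :
    projk (S k) (∑ l, d l) = d k := by
  funext x
  by_cases hx : x ∈ S k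
  · rw [projk, if_pos hx, Finset.sum_apply, Finset.sum_eq_single k]
    · intro l _ hl
      exact hd l x (Finset.disjoint_left.1 (hdisj k l hl.symm) hx)
    · simp
  · rw [projk, if_neg hx, hd k x hx]

/-- The energy estimate and the monotonicity for one sweep of the relaxed block Jacobi method. -/
lemma relaxed_jacobi_sweep {M N : ℕ} (α : ℝ) (f : Idx M N → ℝ) {Nc : ℕ} (hNc : Nc ≠ 0)
    {S : Fin Nc → Finset (Idx M N)}
    (hdisj : ∀ k l, k ≠ l → Disjoint (S k) (S l)) (hcover : ∀ x : Idx M N, ∃ k, x ∈ S k)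
    {q q' r : Idx M N → ℝ × ℝ} (hq : q ∈ Cset M N) (hr : r ∈ Cset M N)
    {s : ∀ k : Fin Nc, {x // x ∈ S k} → ℝ × ℝ} (hs : ∀ k, s k ∈ Ck (S k))
    (hmin : ∀ k, ∀ rk ∈ Ck (S k), Fk α f (S k) (s k) q ≤ Fk α f (S k) rk q)
    (hq' : q' = (1 / (Nc : ℝ)) • ∑ k, (Ek (S k) (s k) + (q - projk (S k) q))) :
    (Nc : ℝ) * F α f q' + Nc * Ddist S r q'
        ≤ (Nc - 1) * F α f q + F α f r + Nc * Ddist S r q ∧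
      F α f q' ≤ F α f q := by
  have hN0 : (Nc : ℝ) ≠ 0 := Nat.cast_ne_zero.2 hNc
  have hNpos : (0 : ℝ) < Nc := by positivity
  set d : Fin Nc → Idx M N → ℝ × ℝ := fun k => Ek (S k) (s k) - projk (S k) q with hd
  set e : Fin Nc → Idx M N → ℝ × ℝ := fun k => projk (S k) (r - q) with he
  have hdsupp : ∀ k, ∀ x ∉ S k, d k x = 0 := by
    intro k x hx
    simp [hd, Ek, projk, hx]
  have hstep : q' = q + (1 / (Nc : ℝ)) • ∑ k, d k := by
    have hterm : ∀ k, Ek (S k) (s k) + (q - projk (S k) q) = q + d k := fun k => by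
      simp only [hd]; abel
    rw [hq']
    simp only [hterm, sum_add_distrib, sum_const, card_univ, Fintype.card_fin, smul_add]
    rw [← Nat.cast_smul_eq_nsmul ℝ, smul_smul, one_div_mul_cancel hN0, one_smul]
  have herr : ∀ k, projk (S k) (r - q') = e k - (1 / (Nc : ℝ)) • d k := by
    intro k
    rw [← projk_sum_of_support hdisj hdsupp k, hstep]
    funext x
    by_cases hx : x ∈ S k
    · simp only [projk, he, hx, if_true, Pi.sub_apply, Pi.add_apply, Pi.smul_apply]
      abel
    · simp [projk, he, hx]
  have hesum : ∑ k, e k = r - q := sum_projk hdisj hcover _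
  set A := divLin M N
  set g := A q + WithLp.toLp 2 (α • f) with hg
  have hFadd : ∀ v, F α f (q + v) = 1 / 2 * ‖g + A v‖ ^ 2 := by
    intro v
    rw [F_eq_norm_sq, map_add, hg, add_right_comm]
  have hFq : F α f q = 1 / 2 * ‖g‖ ^ 2 := F_eq_norm_sq α f q
  have hFr : F α f r = 1 / 2 * ‖g + ∑ k, A (e k)‖ ^ 2 := by
    rw [← map_sum, ← hFadd, hesum, add_sub_cancel]
  have hFq' : F α f q' = 1 / 2 * ‖g + (1 / (Nc : ℝ)) • ∑ k, A (d k)‖ ^ 2 := by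
    rw [← map_sum, ← map_smul, ← hFadd, hstep]
  have hlocal : ∀ k, Fk α f (S k) (s k) q = 1 / 2 * ‖g + A (d k)‖ ^ 2 := by
    intro k
    rw [Fk, ← hFadd]
    congr 1
    simp only [hd]
    abel
  have hopt : ∀ k, 0 ≤ inner ℝ (g + A (d k)) (A (e k) - A (d k)) := by
    intro k
    refine inner_nonneg_of_norm_sq_le_segment fun t ht0 ht1 => ?_
    have hmem : (1 - t) • s k + t • Rk (S k) r ∈ Ck (S k) :=
      convex_Ck (S k) (hs k) ⟨r, hr, rfl⟩ (by linarith) ht0 (by ring)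
    have hle := hmin k _ hmem
    have heq : Ek (S k) ((1 - t) • s k + t • Rk (S k) r) + (q - projk (S k) q)
        = q + (d k + t • (e k - d k)) := by
      funext x
      by_cases hx : x ∈ S k
      · simp only [Ek, Rk, projk, hd, he, hx, dif_pos, if_true, Pi.sub_apply, Pi.add_apply,
          Pi.smul_apply]
        module
      · simp [Ek, projk, hd, he, hx]
    rw [hlocal, Fk, heq, hFadd, A.map_add (d k), A.map_smul, A.map_sub (e k), ← add_assoc] at hle
    linarith
  constructor
  · have h := relaxed_jacobi_step hNc g (fun k => A (d k)) (fun k => A (e k)) hopt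
    have hDq : Ddist S r q = ∑ k, 1 / 2 * ‖A (e k)‖ ^ 2 := by
      simp only [Ddist, normVsq_divOp, he, A]
    have hDq' : Ddist S r q' = ∑ k, 1 / 2 * ‖A (e k) - (1 / (Nc : ℝ)) • A (d k)‖ ^ 2 := by
      simp only [Ddist, normVsq_divOp, herr, map_sub, map_smul, A]
    rw [hFq, hFr, hFq', hDq, hDq']
    exact h
  · have hdec : ∀ k, ‖g + A (d k)‖ ^ 2 ≤ ‖g‖ ^ 2 := by
      intro k
      have hle := hmin k (Rk (S k) q) ⟨q, hq, rfl⟩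
      have heq : Ek (S k) (Rk (S k) q) + (q - projk (S k) q) = q := by
        have : Ek (S k) (Rk (S k) q) = projk (S k) q := by
          funext x
          simp [Ek, Rk, projk]
        rw [this, add_sub_cancel]
      rw [hlocal, Fk, heq, hFq] at hle
      linarith
    have hJ := card_mul_norm_sq_average_le hNc g fun k => A (d k)
    have hS : ∑ k, ‖g + A (d k)‖ ^ 2 ≤ Nc * ‖g‖ ^ 2 := by
      simpa using sum_le_sum fun k (_ : k ∈ univ) => hdec k
    have := le_of_mul_le_mul_left (hJ.trans hS) hNpos
    rw [hFq, hFq']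
    linarith

lemma Ddist_nonneg {M N Nc : ℕ} (S : Fin Nc → Finset (Idx M N)) (p q : Idx M N → ℝ × ℝ) :
    0 ≤ Ddist S p q :=
  sum_nonneg fun _ _ => mul_nonneg (by norm_num) (sum_nonneg fun _ _ => sq_nonneg _)

theorem relaxed_jacobi_rate (M N : ℕ) (α : ℝ) (hα : 0 < α) (f : Idx M N → ℝ)
    (Nc : ℕ) (S : Fin Nc → Finset (Idx M N))
    (hdisj : ∀ k l, k ≠ l → Disjoint (S k) (S l))
    (hcover : ∀ x : Idx M N, ∃ k, x ∈ S k)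
    (p : ℕ → Idx M N → ℝ × ℝ) (hp0 : p 0 ∈ Cset M N)
    (s : ∀ _ : ℕ, ∀ k : Fin Nc, {x // x ∈ S k} → ℝ × ℝ)
    (hs : ∀ n k, s n k ∈ Ck (S k))
    (hmin : ∀ n k, ∀ rk ∈ Ck (S k),
      Fk α f (S k) (s n k) (p n) ≤ Fk α f (S k) rk (p n))
    (hrec : ∀ n, p (n + 1) =
      (1 / (Nc : ℝ)) • ∑ k, (Ek (S k) (s n k) + (p n - projk (S k) (p n))))
    (pstar : Idx M N → ℝ × ℝ) (hpstar : pstar ∈ Cset M N)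
    (hstar : ∀ r ∈ Cset M N, F α f pstar ≤ F α f r)
    : ∀ n : ℕ, 1 ≤ n →
      F α f (p n) - F α f pstar ≤
        ((Nc : ℝ) * Ddist S pstar (p 0)
          + ((Nc : ℝ) - 1) * (F α f (p 0) - F α f pstar)) / (n : ℝ) := by
  intro n hn
  rcases Nat.eq_zero_or_pos Nc with rfl | hNc
  · have : IsEmpty (Idx M N) := ⟨fun x => (hcover x).choose.elim0⟩
    simp [F, normVsq]
  have hN1 : (1 : ℝ) ≤ Nc := by exact_mod_cast hNc
  have hmem : ∀ n, p n ∈ Cset M N := by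
    intro n
    induction n with
    | zero => exact hp0
    | succ n ih =>
      rw [hrec, smul_sum]
      refine (convex_Cset M N).sum_mem (fun _ _ => by positivity) ?_
        fun k _ => Ek_add_mem_Cset (hs n k) ih
      simp [hNc.ne']
  have hsweep := fun n => relaxed_jacobi_sweep α f hNc.ne' hdisj hcover (hmem n) hpstar (hs n)
    (hmin n) (hrec n)
  have hmain : ∀ n : ℕ, (n : ℝ) * (F α f (p n) - F α f pstar)
      + ((Nc : ℝ) * Ddist S pstar (p n) + ((Nc : ℝ) - 1) * (F α f (p n) - F α f pstar))
      ≤ (Nc : ℝ) * Ddist S pstar (p 0) + ((Nc : ℝ) - 1) * (F α f (p 0) - F α f pstar) := by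
    intro n
    induction n with
    | zero => simp
    | succ n ih =>
      obtain ⟨h1, h2⟩ := hsweep n
      have h3 := mul_le_mul_of_nonneg_left h2 (Nat.cast_nonneg (α := ℝ) n)
      push_cast
      linarith
  have hD : 0 ≤ (Nc : ℝ) * Ddist S pstar (p n) :=
    mul_nonneg (by linarith) (Ddist_nonneg S _ _)
  have hE : 0 ≤ ((Nc : ℝ) - 1) * (F α f (p n) - F α f pstar) :=
    mul_nonneg (by linarith) (sub_nonneg.2 (hstar _ (hmem n)))
  rw [le_div_iff₀ (by exact_mod_cast hn)]
  linarith [hmain n]
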